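/- Corollary 2.3: Let p : ℕ → ℝ with p_i ≥ 0, Σ_{i=0}^∞ p_i = 1, and p_0 > p_1 > p_2 > ⋯ (strictly decreasing). Then p is DPCP: there exist λ > 0 and a real sequence (α_k)_{k≥1} with Σ_{k≥1} α_k = 1 and Σ_{k≥1} |α_k| < ∞ such that Σ_{i=0}^∞ p_i z^i = exp(λ Σ_{k≥1} α_k (z^k − 1)) for all complex z with |z| ≤ 1. In particular Σ_{i=0}^∞ p_i z^i ≠ 0 for all |z| ≤ 1. -/

import Mathlib

open Filter Topology

theorem aux_range_exp {A : Type*} [NormedCommRing A] [NormedAlgebra ℂ A] [CompleteSpace A]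
    (a : A) (ha : IsUnit a) :
    ∀ᶠ b in 𝓝 a, (b ∈ Set.range (NormedSpace.exp : A → A) ↔ a ∈ Set.range (NormedSpace.exp : A → A)) := by
  let _ : NormedAlgebra ℚ A := NormedAlgebra.restrictScalars ℚ ℂ A
  obtain ⟨u, rfl⟩ := ha
  have h1 : Set.range (NormedSpace.exp : A → A) ∈ 𝓝 (1 : A) := by
    have h := (hasStrictFDerivAt_exp_zero (𝕂 := ℂ) (𝔸 := A)).map_nhds_eq_of_surj
      (by ext x; simp)
    rw [NormedSpace.exp_zero] at h
    rw [← h]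
    exact Filter.range_mem_map
  have hc : Tendsto (fun b : A => (↑u⁻¹ : A) * b) (𝓝 (u : A)) (𝓝 1) := by
    have : Continuous (fun b : A => (↑u⁻¹ : A) * b) := by fun_prop
    simpa using this.tendsto (u : A)
  filter_upwards [hc h1] with b hb
  obtain ⟨l, hl⟩ := hb
  have hb' : b = u * NormedSpace.exp l := by rw [hl]; simp
  constructor
  · rintro ⟨x, hx⟩
    refine ⟨x + -l, ?_⟩
    have : (u : A) = u * (NormedSpace.exp l * NormedSpace.exp (-l)) := by
      rw [← NormedSpace.exp_add]; simp
    rw [NormedSpace.exp_add, hx, hb', mul_assoc, ← this]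
  · rintro ⟨x, hx⟩
    exact ⟨x + l, by rw [NormedSpace.exp_add, hx, hb']⟩

theorem aux_log {A : Type*} [NormedCommRing A] [NormedAlgebra ℂ A] [CompleteSpace A]
    [NormOneClass A] (s : A) (hs : ‖s‖ ≤ 1) (p : ℕ → ℂ) (hp : Summable fun i => ‖p i‖)
    (hG : ∀ z : ℂ, ‖z‖ ≤ 1 → ∑' i, p i * z ^ i ≠ 0) :
    ∃ L : A, NormedSpace.exp L = ∑' i, p i • s ^ i := by
  have hb : ∀ (r : unitInterval) i, ‖(p i * ((r : ℝ) : ℂ) ^ i) • s ^ i‖ ≤ ‖p i‖ := by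
    intro r i
    rw [norm_smul, norm_mul, norm_pow, Complex.norm_real, Real.norm_eq_abs, abs_of_nonneg r.2.1]
    have h1 : (r : ℝ) ^ i ≤ 1 := pow_le_one₀ r.2.1 r.2.2
    have h2 : ‖s ^ i‖ ≤ 1 := (norm_pow_le s i).trans (pow_le_one₀ (norm_nonneg _) hs)
    have h0 : (0:ℝ) ≤ (r : ℝ) ^ i := pow_nonneg r.2.1 i
    calc _ ≤ ‖p i‖ * 1 * 1 := by gcongr
      _ = _ := by ring
  let G : unitInterval → A := fun r => ∑' i, (p i * ((r : ℝ) : ℂ) ^ i) • s ^ i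
  have hGc : Continuous G := continuous_tsum (fun i => by fun_prop) hp (fun i r => hb r i)
  have hGs : ∀ r, Summable fun i => (p i * ((r : unitInterval) : ℂ) ^ i) • s ^ i :=
    fun r => Summable.of_norm_bounded hp (hb r)
  have hu : ∀ r, IsUnit (G r) := by
    intro r
    by_contra hcon
    obtain ⟨f, hf⟩ := WeakDual.CharacterSpace.exists_apply_eq_zero hcon
    have hfs : ‖f s‖ ≤ 1 := (AlgHom.norm_apply_le_self f s).trans hs
    refine hG ((r : ℝ) * f s) ?_ ?_
    · rw [norm_mul, Complex.norm_real, Real.norm_eq_abs, abs_of_nonneg r.2.1]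
      exact mul_le_one₀ r.2.2 (norm_nonneg _) hfs
    · have h := ((hGs r).hasSum.map f (map_continuous f)).tsum_eq
      change _ = f (G r) at h
      rw [← hf, ← h]
      refine tsum_congr fun i => ?_
      simp [mul_pow, mul_assoc]
  have hloc : IsLocallyConstant (fun r => G r ∈ Set.range (NormedSpace.exp : A → A)) := by
    rw [IsLocallyConstant.iff_eventually_eq]
    intro r
    filter_upwards [hGc.continuousAt.eventually (aux_range_exp (G r) (hu r))] with t ht
    exact propext ht
  have h0 : G 0 ∈ Set.range (NormedSpace.exp : A → A) := by
    have hp0 : p 0 ≠ 0 := by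
      have := hG 0 (by simp)
      rwa [tsum_eq_single 0 (fun i hi => by simp [hi]), pow_zero, mul_one] at this
    refine ⟨algebraMap ℂ A (Complex.log (p 0)), ?_⟩
    rw [← NormedSpace.algebraMap_exp_comm, ← Complex.exp_eq_exp_ℂ, Complex.exp_log hp0]
    simp only [G]
    rw [tsum_eq_single 0 (fun i hi => by simp [hi])]
    simp [Algebra.algebraMap_eq_smul_one]
  have h1 := (hloc.apply_eq_of_preconnectedSpace 0 1).mp h0
  obtain ⟨L, hL⟩ := h1
  exact ⟨L, by rw [hL]; simp [G]⟩

theorem aux_log_char {A : Type*} [NormedCommRing A] [NormedAlgebra ℂ A] [CompleteSpace A]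
    [NormOneClass A] (s : A) (hs : ‖s‖ ≤ 1) (p : ℕ → ℂ) (hp : Summable fun i => ‖p i‖)
    (hG : ∀ z : ℂ, ‖z‖ ≤ 1 → ∑' i, p i * z ^ i ≠ 0) :
    ∃ L : A, ∀ f : A →ₐ[ℂ] ℂ, Continuous f →
      ∑' i, p i * (f s) ^ i = Complex.exp (f L) := by
  obtain ⟨L, hL⟩ := aux_log s hs p hp hG
  refine ⟨L, fun f hf => ?_⟩
  let _ : NormedAlgebra ℚ A := NormedAlgebra.restrictScalars ℚ ℂ A
  have h1 : f (NormedSpace.exp L) = NormedSpace.exp (f L) := NormedSpace.map_exp _ hf L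
  rw [← Complex.exp_eq_exp_ℂ] at h1
  rw [← h1, hL]
  have hsum : Summable fun i => p i • s ^ i := by
    refine Summable.of_norm_bounded hp fun i => ?_
    rw [norm_smul]
    exact mul_le_of_le_one_right (norm_nonneg _)
      ((norm_pow_le s i).trans (pow_le_one₀ (norm_nonneg _) hs))
  have h2 := (hsum.hasSum.map f hf).tsum_eq
  rw [← h2]
  refine tsum_congr fun i => ?_
  simp
theorem aux_nonvanish (p : ℕ → ℝ) (hp : ∀ i, 0 ≤ p i) (hp1 : (∑' i, p i) = 1)
    (hdec : ∀ i : ℕ, p (i + 1) < p i) (z : ℂ) (hz : ‖z‖ ≤ 1) :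
    (∑' i, (p i : ℂ) * z ^ i) ≠ 0 := by
  have hs : Summable p := by
    by_contra h
    rw [tsum_eq_zero_of_not_summable h] at hp1
    exact zero_ne_one hp1
  have hs1 : Summable fun i => p (i + 1) := (summable_nat_add_iff 1).2 hs
  intro h0
  have hpow : ∀ i, ‖z ^ i‖ ≤ 1 := fun i => by
    rw [norm_pow]; exact pow_le_one₀ (norm_nonneg _) hz
  have hsz : Summable fun i => (p i : ℂ) * z ^ i := by
    refine Summable.of_norm_bounded hs fun i => ?_
    rw [norm_mul, Complex.norm_real, Real.norm_eq_abs, abs_of_nonneg (hp i)]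
    exact mul_le_of_le_one_right (hp i) (hpow i)
  have hsz1 : Summable fun i => (p (i+1) : ℂ) * z ^ (i+1) :=
    (summable_nat_add_iff (f := fun i => (p i : ℂ) * z ^ i) 1).2 hsz
  have e1 := hsz.tsum_eq_zero_add
  rw [h0] at e1
  have hsz2 : Summable fun i => (p i : ℂ) * z ^ (i + 1) := by
    have h := hsz.mul_right z
    have hfe : (fun i => (p i : ℂ) * z ^ (i + 1)) = fun i => (p i : ℂ) * z ^ i * z := by
      funext i; ring
    rwa [hfe]
  have e2 : ∑' i, (p i : ℂ) * z ^ (i + 1) = 0 := by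
    rw [← zero_mul z, ← h0, ← tsum_mul_right]
    exact tsum_congr fun i => by ring
  -- sum of d_i z^{i+1} = p 0
  have e3 : HasSum (fun i => ((p i : ℂ) - p (i+1)) * z ^ (i+1)) (p 0 : ℂ) := by
    have h := hsz2.hasSum.sub hsz1.hasSum
    rw [e2] at h
    have : (0 : ℂ) - ∑' i, (p (i+1) : ℂ) * z ^ (i+1) = p 0 := by
      simp only [pow_zero, mul_one] at e1
      linear_combination e1
    rw [this] at h
    have hfe : (fun i => ((p i : ℂ) - p (i+1)) * z ^ (i+1)) =
        fun i => (p i : ℂ) * z ^ (i + 1) - (p (i+1) : ℂ) * z ^ (i+1) := by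
      funext i; ring
    rwa [hfe]
  have e4 : HasSum (fun i => p i - p (i+1)) (p 0) := by
    have h := hs.hasSum.sub hs1.hasSum
    rw [hs.tsum_eq_zero_add] at h
    simpa using h
  have e5 : HasSum (fun i => (p i - p (i+1)) * (1 - (z ^ (i+1)).re)) 0 := by
    have h := e4.sub (Complex.hasSum_re e3)
    simp only [Complex.ofReal_re, sub_self] at h
    have hfe : (fun i => (p i - p (i+1)) * (1 - (z ^ (i+1)).re)) =
        fun i => p i - p (i+1) - (((p i : ℂ) - p (i+1)) * z ^ (i+1)).re := by
      funext i
      rw [← Complex.ofReal_sub, Complex.re_ofReal_mul]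
      ring
    rwa [hfe]
  have e6 := (hasSum_zero_iff_of_nonneg (fun i => mul_nonneg (sub_nonneg.2 (hdec i).le)
    (sub_nonneg.2 ((Complex.re_le_norm _).trans (hpow _))))).1 e5
  have e7 := congrFun e6 0
  simp only [zero_add, pow_one, Pi.zero_apply] at e7
  have hre : z.re = 1 := by
    rcases mul_eq_zero.1 e7 with h | h
    · have := hdec 0; simp at this; linarith
    · linarith
  have hz1 : z = 1 := by
    have := Complex.sq_norm z
    rw [Complex.normSq_apply, hre] at this
    have him : z.im = 0 := by
      have : ‖z‖^2 ≤ 1 := pow_le_one₀ (norm_nonneg _) hz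
      nlinarith [sq_nonneg z.im]
    exact Complex.ext (by simpa using hre) (by simpa using him)
  subst hz1
  simp only [one_pow, mul_one, ← Complex.ofReal_tsum, hp1] at h0
  simp at h0

noncomputable abbrev ell1 := lp (fun _ : ℕ => ℂ) 1

theorem ell1_hasSum (x : ell1) : HasSum (fun i => ‖x i‖) ‖x‖ := by
  have := lp.hasSum_norm (p := 1) (by simp) x
  simpa using this

theorem ell1_mem (f : ℕ → ℂ) (hf : Summable fun i => ‖f i‖) : Memℓp f 1 :=
  memℓp_gen (by simpa using hf)

/-- the shifted sequence -/
def shiftSeq (f : ℕ → ℂ) : ℕ → ℂ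
  | 0 => 0
  | (n + 1) => f n

theorem shiftSeq_hasSum (x : ell1) : HasSum (fun i => ‖shiftSeq x i‖) ‖x‖ := by
  rw [← hasSum_nat_add_iff' 1]
  simpa [shiftSeq] using ell1_hasSum x

noncomputable def shiftLin : ell1 →ₗ[ℂ] ell1 where
  toFun x := ⟨shiftSeq x, ell1_mem _ (shiftSeq_hasSum x).summable⟩
  map_add' x y := by
    ext i
    cases i
    · change (0 : ℂ) = 0 + 0
      simp
    · rfl
  map_smul' c x := by
    ext i
    cases i <;> simp [shiftSeq]

noncomputable def shiftOp : ell1 →L[ℂ] ell1 :=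
  shiftLin.mkContinuous 1 (fun x => by
    rw [one_mul]
    refine le_of_eq ((ell1_hasSum (shiftLin x)).unique (shiftSeq_hasSum x)))

theorem shiftOp_norm : ‖shiftOp‖ ≤ 1 := LinearMap.mkContinuous_norm_le _ zero_le_one _

theorem shiftOp_zero (x : ell1) : (shiftOp x) 0 = 0 := rfl
theorem shiftOp_succ (x : ell1) (n : ℕ) : (shiftOp x) (n + 1) = x n := rfl

theorem ell1_bound (z : ℂ) (hz : ‖z‖ ≤ 1) (x : ell1) (i : ℕ) : ‖x i * z ^ i‖ ≤ ‖x i‖ := by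
  rw [norm_mul, norm_pow]
  exact mul_le_of_le_one_right (norm_nonneg _) (pow_le_one₀ (norm_nonneg _) hz)

theorem ell1_summable (z : ℂ) (hz : ‖z‖ ≤ 1) (x : ell1) : Summable fun i => x i * z ^ i :=
  Summable.of_norm_bounded (ell1_hasSum x).summable (ell1_bound z hz x)

noncomputable def evalLin (z : ℂ) (hz : ‖z‖ ≤ 1) : ell1 →ₗ[ℂ] ℂ where
  toFun x := ∑' i, x i * z ^ i
  map_add' x y := by
    rw [← (ell1_summable z hz x).tsum_add (ell1_summable z hz y)]
    exact tsum_congr fun i => by simp [add_mul]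
  map_smul' c x := by
    simp [mul_assoc, tsum_mul_left]

noncomputable def evalOp (z : ℂ) (hz : ‖z‖ ≤ 1) : ell1 →L[ℂ] ℂ :=
  (evalLin z hz).mkContinuous 1 (fun x => by
    rw [one_mul]
    exact tsum_of_norm_bounded (ell1_hasSum x) (ell1_bound z hz x))

theorem evalOp_apply (z : ℂ) (hz : ‖z‖ ≤ 1) (x : ell1) : evalOp z hz x = ∑' i, x i * z ^ i := rfl

theorem evalOp_shift (z : ℂ) (hz : ‖z‖ ≤ 1) (x : ell1) :
    evalOp z hz (shiftOp x) = z * evalOp z hz x := by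
  rw [evalOp_apply, evalOp_apply, (ell1_summable z hz (shiftOp x)).tsum_eq_zero_add, shiftOp_zero,
    ← tsum_mul_left]
  simp only [zero_mul, zero_add]
  exact tsum_congr fun i => by rw [shiftOp_succ]; ring

noncomputable def e0 : ell1 := lp.single 1 0 1

theorem evalOp_e0 (z : ℂ) (hz : ‖z‖ ≤ 1) : evalOp z hz e0 = 1 := by
  rw [evalOp_apply, tsum_eq_single 0]
  · simp [e0]
  · intro i hi
    simp [e0, Pi.single_eq_of_ne hi]

instance : Nontrivial ell1 := ⟨e0, 0, fun h => by
  have := evalOp_e0 0 (by simp)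
  rw [h, map_zero] at this
  exact zero_ne_one this⟩

/-- operators for which evaluation at `z` is multiplicative -/
noncomputable def multAlg (z : ℂ) (hz : ‖z‖ ≤ 1) : Subalgebra ℂ (ell1 →L[ℂ] ell1) where
  carrier := {T | ∀ x, evalOp z hz (T x) = evalOp z hz (T e0) * evalOp z hz x}
  mul_mem' {S T} hS hT x := by
    simp only [mul_apply_eq_comp]
    rw [hS (T x), hS (T e0), hT x]; ring
  add_mem' {S T} hS hT x := by
    simp only [add_apply, map_add]
    rw [hS x, hT x]; ring
  algebraMap_mem' c x := by
    simp [Algebra.algebraMap_eq_smul_one, evalOp_e0]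

theorem multAlg_closed (z : ℂ) (hz : ‖z‖ ≤ 1) : IsClosed (multAlg z hz : Set (ell1 →L[ℂ] ell1)) := by
  have : (multAlg z hz : Set (ell1 →L[ℂ] ell1)) =
    ⋂ x, {T | evalOp z hz (T x) = evalOp z hz (T e0) * evalOp z hz x} := by
    ext T; simp [multAlg]
  rw [this]
  refine isClosed_iInter fun x => isClosed_eq ?_ ?_ <;> fun_prop

theorem elemental_le (z : ℂ) (hz : ‖z‖ ≤ 1) : Algebra.elemental ℂ shiftOp ≤ multAlg z hz := by
  refine Algebra.elemental.le_of_mem (multAlg_closed z hz) fun x => ?_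
  rw [evalOp_shift, evalOp_shift, evalOp_e0]; ring

noncomputable abbrev wienerAlg := Algebra.elemental ℂ shiftOp

noncomputable def wienerChar (z : ℂ) (hz : ‖z‖ ≤ 1) : wienerAlg →ₐ[ℂ] ℂ where
  toFun T := evalOp z hz ((T : ell1 →L[ℂ] ell1) e0)
  map_one' := evalOp_e0 z hz
  map_zero' := by simp
  map_mul' S T := elemental_le z hz S.2 _
  map_add' S T := by simp
  commutes' c := by simp [Algebra.algebraMap_eq_smul_one, evalOp_e0]

theorem wienerChar_continuous (z : ℂ) (hz : ‖z‖ ≤ 1) : Continuous (wienerChar z hz) := by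
  change Continuous fun T : wienerAlg => evalOp z hz ((T : ell1 →L[ℂ] ell1) e0)
  fun_prop


/-- the commutative normed ring structure -/
@[reducible] noncomputable def wienerRing : NormedCommRing wienerAlg :=
  { (inferInstance : NormedRing wienerAlg) with
    mul_comm := fun a b => mul_comm a b }

/-- Wiener-Lévy for the logarithm -/
theorem wiener_log (p : ℕ → ℂ) (hp : Summable fun i => ‖p i‖)
    (hG : ∀ z : ℂ, ‖z‖ ≤ 1 → ∑' i, p i * z ^ i ≠ 0) :
    ∃ a : ℕ → ℂ, (Summable fun i => ‖a i‖) ∧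
      ∀ z : ℂ, ‖z‖ ≤ 1 → ∑' i, p i * z ^ i = Complex.exp (∑' i, a i * z ^ i) := by
  let s : wienerAlg := ⟨shiftOp, Algebra.elemental.self_mem ℂ shiftOp⟩
  have hs : ‖s‖ ≤ 1 := shiftOp_norm
  have hone : NormOneClass wienerAlg := ⟨norm_one (α := ell1 →L[ℂ] ell1)⟩
  have hcomp : CompleteSpace wienerAlg := inferInstance
  let nalg : NormedAlgebra ℂ wienerAlg := inferInstance
  obtain ⟨L, hL⟩ := @aux_log_char wienerAlg wienerRing nalg hcomp hone s hs p hp hG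
  refine ⟨fun i => ((L : ell1 →L[ℂ] ell1) e0) i, (ell1_hasSum _).summable, fun z hz => ?_⟩
  have h1 := hL (wienerChar z hz) (wienerChar_continuous z hz)
  have h3 : wienerChar z hz s = z := by
    change evalOp z hz (shiftOp e0) = z
    rw [evalOp_shift, evalOp_e0, mul_one]
  rw [h3] at h1
  exact h1

theorem strictly_decreasing_implies_dpcp
    (p : ℕ → ℝ) (hp : ∀ i, 0 ≤ p i) (hp1 : (∑' i, p i) = 1)
    (hdec : ∀ i : ℕ, p (i + 1) < p i) :
    (∃ lam : ℝ, 0 < lam ∧ ∃ α : ℕ → ℝ,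
      (∑' k, α k) = 1 ∧ Summable (fun k => |α k|) ∧
      ∀ z : ℂ, ‖z‖ ≤ 1 →
        (∑' i, (p i : ℂ) * z ^ i) =
          Complex.exp ((lam : ℂ) * ∑' k, (α k : ℂ) * (z ^ (k + 1) - 1))) ∧
    (∀ z : ℂ, ‖z‖ ≤ 1 → (∑' i, (p i : ℂ) * z ^ i) ≠ 0) := by
  have hnv := aux_nonvanish p hp hp1 hdec
  refine ⟨?_, hnv⟩
  have hs : Summable p := by
    by_contra h
    rw [tsum_eq_zero_of_not_summable h] at hp1
    exact zero_ne_one hp1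
  have hsn : Summable fun i => ‖(p i : ℂ)‖ := by
    refine hs.congr fun i => ?_
    rw [Complex.norm_real, Real.norm_eq_abs, abs_of_nonneg (hp i)]
  obtain ⟨a, ha, hexp⟩ := wiener_log (fun i => (p i : ℂ)) hsn hnv
  have hbd : ∀ (c : ℕ → ℂ) (z : ℂ), ‖z‖ ≤ 1 → ∀ i, ‖c i * z ^ i‖ ≤ ‖c i‖ := by
    intro c z hz i
    rw [norm_mul, norm_pow]
    exact mul_le_of_le_one_right (norm_nonneg _) (pow_le_one₀ (norm_nonneg _) hz)
  have hsm : ∀ (c : ℕ → ℂ), (Summable fun i => ‖c i‖) → ∀ z : ℂ, ‖z‖ ≤ 1 →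
      Summable fun i => c i * z ^ i :=
    fun c hc z hz => Summable.of_norm_bounded hc (hbd c z hz)
  have hct : ∀ (c : ℕ → ℂ), (Summable fun i => ‖c i‖) →
      ContinuousOn (fun z => ∑' i, c i * z ^ i) (Metric.closedBall (0:ℂ) 1) := by
    intro c hc
    exact continuousOn_tsum (fun i => by fun_prop) hc
      (fun i z hz => hbd c z (by simpa using hz) i)
  let b : ℕ → ℝ := fun i => (a i).re
  have hb : Summable fun i => ‖(b i : ℂ)‖ := by
    refine Summable.of_nonneg_of_le (fun i => norm_nonneg _) (fun i => ?_) ha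
    rw [Complex.norm_real]
    exact Complex.abs_re_le_norm _
  have hac : Summable fun i => ‖(starRingEnd ℂ) (a i)‖ := by simpa using ha
  -- conjugate symmetric version
  have hconj : ∀ z : ℂ, ‖z‖ ≤ 1 →
      ∑' i, (p i : ℂ) * z ^ i = Complex.exp (∑' i, (starRingEnd ℂ) (a i) * z ^ i) := by
    intro z hz
    have h := congrArg (starRingEnd ℂ) (hexp ((starRingEnd ℂ) z) (by simpa using hz))
    rw [← Complex.exp_conj, Complex.conj_tsum, Complex.conj_tsum] at h
    simpa using h
  have hb_eq : ∀ z : ℂ, ‖z‖ ≤ 1 →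
      ∑' i, (p i : ℂ) * z ^ i = Complex.exp (∑' i, (b i : ℂ) * z ^ i) := by
    have key := (convex_closedBall (0:ℂ) 1).isPreconnected.eq_of_sq_eq
      (f := fun z => Complex.exp (∑' i, (b i : ℂ) * z ^ i))
      (g := fun z => ∑' i, (p i : ℂ) * z ^ i)
      (Complex.continuous_exp.comp_continuousOn (hct _ hb)) (hct _ hsn) ?_ ?_
      (y := 0) (by simp) ?_
    · intro z hz
      exact (key (by simpa using hz)).symm
    · intro z hz
      have hz' : ‖z‖ ≤ 1 := by simpa using hz
      simp only [Pi.pow_apply]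
      rw [← Complex.exp_nat_mul, sq, hconj z hz', ← hconj z hz']
      nth_rewrite 1 [hexp z hz']
      rw [hconj z hz', ← Complex.exp_add,
        ← (hsm a ha z hz').tsum_add (hsm _ hac z hz'), ← tsum_mul_left]
      congr 1
      refine tsum_congr fun i => ?_
      rw [← add_mul, Complex.add_conj]
      push_cast
      ring
    · intro z hz
      exact hnv z (by simpa using hz)
    · have h0 : ∀ c : ℕ → ℂ, ∑' i, c i * (0:ℂ) ^ i = c 0 := by
        intro c
        rw [tsum_eq_single 0 (fun i hi => by simp [hi])]
        simp
      have h := hexp 0 (by simp)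
      rw [h0, h0] at h
      rw [h0, h0, ← Complex.ofReal_exp]
      have hn := congrArg norm h
      rw [Complex.norm_exp, Complex.norm_real, Real.norm_eq_abs, abs_of_nonneg (hp 0)] at hn
      rw [hn]
  have hbs : Summable b := by
    refine Summable.of_norm ?_
    simpa using hb
  have hsum0 : ∑' i, b i = 0 := by
    have h := hb_eq 1 (by simp)
    simp only [one_pow, mul_one, ← Complex.ofReal_tsum, hp1, ← Complex.ofReal_exp] at h
    have h' : (1:ℝ) = Real.exp (∑' i, b i) := by exact_mod_cast h
    exact (Real.exp_eq_one_iff _).1 h'.symm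
  have hb0 : p 0 = Real.exp (b 0) := by
    have h := hb_eq 0 (by simp)
    rw [tsum_eq_single 0 (fun i hi => by simp [hi]),
      tsum_eq_single 0 (fun i hi => by simp [hi])] at h
    simp only [pow_zero, mul_one, ← Complex.ofReal_exp] at h
    exact_mod_cast h
  have hp0lt : p 0 < 1 := by
    have h1 : 0 < p 1 := (hp 2).trans_lt (hdec 1)
    have h2 := hs.sum_le_tsum (Finset.range 2) (fun i _ => hp i)
    rw [hp1, Finset.sum_range_succ, Finset.sum_range_one] at h2
    linarith
  have hb0neg : b 0 < 0 := by
    rw [hb0] at hp0lt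
    exact Real.exp_lt_one_iff.1 hp0lt
  have hlam : ∑' k, b (k + 1) = - b 0 := by
    have := hbs.tsum_eq_zero_add
    linarith
  have hbs1 : Summable fun k => b (k + 1) := (summable_nat_add_iff 1).2 hbs
  have hne : (-b 0) ≠ 0 := by linarith
  have hneC : ((-b 0 : ℝ) : ℂ) ≠ 0 := by exact_mod_cast hne
  refine ⟨-b 0, by linarith, fun k => b (k + 1) / (-b 0), ?_, ?_, ?_⟩
  · rw [tsum_div_const, hlam, div_self hne]
  · exact (hbs1.div_const _).abs
  · intro z hz
    rw [hb_eq z hz, ← tsum_mul_left]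
    congr 1
    have hz1 := hsm _ hb z hz
    have hz2 : Summable fun k => (b (k+1) : ℂ) * z ^ (k+1) :=
      (summable_nat_add_iff (f := fun i => (b i : ℂ) * z ^ i) 1).2 hz1
    have hz3 : Summable fun k => (b (k+1) : ℂ) := Complex.summable_ofReal.2 hbs1
    have : ∀ k, ((-b 0 : ℝ) : ℂ) * (((b (k+1) / (-b 0) : ℝ) : ℂ) * (z ^ (k+1) - 1))
        = (b (k+1) : ℂ) * z ^ (k+1) - (b (k+1) : ℂ) := by
      intro k
      rw [Complex.ofReal_div]
      field_simp
    rw [tsum_congr this, hz2.tsum_sub hz3, ← Complex.ofReal_tsum, hlam, hz1.tsum_eq_zero_add]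
    push_cast
    ring
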